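/- Let G be a rainbow C_4-saturated graph with vertex set V, let D ⊆ V be a dominating set, and fix v ∈ D. For a connected component C of G[V∖D], let f(C) be the number of edges of G with at least one endpoint in V(C); call C sparse if f(C) = 2|V(C)| − 1. Let L be the set of vertices that lie in some sparse component and have degree exactly 2 in G. Then no connected component C of G[N(v)∖D] that contains a vertex of L and is simultaneously a connected component of G[V∖D] satisfies 3 ≤ |V(C)| ≤ 5. -/

import Mathlib

/-- A proper edge-coloring: any two distinct edges of `G` sharing a vertex
receive different colors. -/
def ProperEdgeColoring {V : Type*} (G : SimpleGraph V) (c : Sym2 V → ℕ) : Prop :=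
  ∀ e₁ ∈ G.edgeSet, ∀ e₂ ∈ G.edgeSet, e₁ ≠ e₂ → (∃ v, v ∈ e₁ ∧ v ∈ e₂) → c e₁ ≠ c e₂

/-- `G` contains a rainbow copy of the cycle `C_k` under the edge-coloring `c`:
there are `k` distinct vertices, cyclically consecutive ones adjacent, whose
`k` cycle edges receive pairwise distinct colors. -/
def HasRainbowCycle {V : Type*} (G : SimpleGraph V) (c : Sym2 V → ℕ) (k : ℕ) : Prop :=
  ∃ f : ZMod k → V, Function.Injective f ∧ (∀ i, G.Adj (f i) (f (i + 1))) ∧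
    Function.Injective (fun i : ZMod k => c s(f i, f (i + 1)))

/-- `G` is (properly) rainbow `C_k`-saturated: some proper edge-coloring of `G`
has no rainbow `C_k`-copy, but for every pair of nonadjacent vertices `x, y`,
every proper edge-coloring of `G + xy` contains a rainbow `C_k`-copy. -/
def RainbowSat {V : Type*} (G : SimpleGraph V) (k : ℕ) : Prop :=
  (∃ c, ProperEdgeColoring G c ∧ ¬ HasRainbowCycle G c k) ∧
  ∀ x y : V, x ≠ y → ¬ G.Adj x y →
    ∀ c, ProperEdgeColoring (G ⊔ SimpleGraph.fromEdgeSet {s(x, y)}) c →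
      HasRainbowCycle (G ⊔ SimpleGraph.fromEdgeSet {s(x, y)}) c k

/-- The subgraph of `G` on the same vertex set keeping only the edges with both
endpoints in `A` (used to model the induced subgraph `G[A]`). -/
def restrictTo {V : Type*} (G : SimpleGraph V) (A : Set V) : SimpleGraph V :=
  SimpleGraph.fromRel (fun x y => G.Adj x y ∧ x ∈ A ∧ y ∈ A)

/-- The vertex set of the connected component of `x` in the graph `H`. -/
def compOf {V : Type*} (H : SimpleGraph V) (x : V) : Set V := {y | H.Reachable x y}

/-- `f(C)`: the number of edges of `G` with at least one endpoint in `C`. -/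
noncomputable def edgesTouching {V : Type*} (G : SimpleGraph V) (C : Set V) : ℕ :=
  {e | e ∈ G.edgeSet ∧ ∃ w ∈ C, w ∈ e}.ncard

/-- A component `C` of `G[V ∖ D]` is sparse if `f(C) = 2|V(C)| − 1`. -/
def SparseComp {V : Type*} (G : SimpleGraph V) (C : Set V) : Prop :=
  edgesTouching G C + 1 = 2 * C.ncard

/-- `L`: the set of vertices lying in some sparse component of `G[V ∖ D]` that
have degree exactly 2 in `G`. -/
def Lset {V : Type*} (G : SimpleGraph V) (D : Set V) : Set V :=
  {w | w ∉ D ∧ SparseComp G (compOf (restrictTo G Dᶜ) w) ∧ (G.neighborSet w).ncard = 2}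

/-- A properly coloured 4-cycle is rainbow as soon as opposite edges have different colours. -/
theorem hasRainbowCycle_four_iff {V : Type*} {G : SimpleGraph V} {c : Sym2 V → ℕ}
    (hc : ProperEdgeColoring G c) :
    HasRainbowCycle G c 4 ↔ ∃ a b d e, a ≠ d ∧ b ≠ e ∧ G.Adj a b ∧ G.Adj b d ∧ G.Adj d e ∧
      G.Adj e a ∧ c s(a, b) ≠ c s(d, e) ∧ c s(b, d) ≠ c s(e, a) := by
  constructor
  · rintro ⟨f, hf, hadj, hcol⟩
    refine ⟨f 0, f 1, f 2, f 3, hf.ne (by decide), hf.ne (by decide), hadj 0, hadj 1, hadj 2,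
      hadj 3, ?_, ?_⟩
    · exact hcol.ne (a₁ := 0) (a₂ := 2) (by decide)
    · exact hcol.ne (a₁ := 1) (a₂ := 3) (by decide)
  · rintro ⟨a, b, d, e, had, hbe, hab, hbd, hde, hea, h₁, h₂⟩
    have key : ∀ x y z, G.Adj x y → G.Adj y z → x ≠ z → c s(x, y) ≠ c s(y, z) := by
      intro x y z hxy hyz hxz
      refine hc _ hxy _ hyz ?_ ⟨y, by simp, by simp⟩
      simp only [ne_eq, Sym2.eq_iff, not_or, not_and]
      exact ⟨fun h => absurd h hxy.ne, fun h => absurd h hxz⟩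
    have k₁ := key _ _ _ hab hbd had
    have k₂ := key _ _ _ hbd hde hbe
    have k₃ := key _ _ _ hde hea had.symm
    have k₄ := key _ _ _ hea hab hbe.symm
    have := hab.ne
    have := hbd.ne
    have := hde.ne
    have := hea.ne
    refine ⟨(![a, b, d, e] : Fin 4 → V), ?_, ?_, ?_⟩
    · change Function.Injective (![a, b, d, e] : Fin 4 → V)
      intro i j
      fin_cases i <;> fin_cases j <;> simp <;> tauto
    · change ∀ i : Fin 4, G.Adj ((![a, b, d, e] : Fin 4 → V) i)
        ((![a, b, d, e] : Fin 4 → V) (i + 1))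
      intro i
      fin_cases i <;> simpa
    · change Function.Injective (fun i : Fin 4 => c s((![a, b, d, e] : Fin 4 → V) i,
        (![a, b, d, e] : Fin 4 → V) (i + 1)))
      have h : (fun i : Fin 4 => c s((![a, b, d, e] : Fin 4 → V) i,
          (![a, b, d, e] : Fin 4 → V) (i + 1))) =
          ![c s(a, b), c s(b, d), c s(d, e), c s(e, a)] := by
        funext i
        fin_cases i <;> simp
      rw [h]
      intro i j
      fin_cases i <;> fin_cases j <;> simp <;> grind

/-- A symmetric matrix with entries below 10 whose nonzero entries are the colours of the edges of
a properly coloured graph without rainbow 4-cycles. -/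
def IsColorTable {m : ℕ} (M : Fin m → Fin m → ℕ) : Prop :=
  (∀ i j, M i j = M j i ∧ M i j < 10) ∧
  (∀ i j l, j ≠ l → M i j ≠ 0 → M i j ≠ M i l) ∧
  ∀ i j k l, (M i j ≠ 0 ∧ i ≠ k ∧ M j k ≠ 0 ∧ j ≠ l ∧ M k l ≠ 0 ∧ M l i ≠ 0) →
    M i j = M k l ∨ M j k = M l i

instance {m : ℕ} (M : Fin m → Fin m → ℕ) : Decidable (IsColorTable M) := by
  unfold IsColorTable
  infer_instance

/-- A rainbow `C₄`-saturated graph has no block `φ`, attached at the cut vertex `φ 0`, which after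
the addition of a missing edge `φ x`, `φ y` has a colouring without rainbow 4-cycles. -/
theorem RainbowSat.false_of_block {V : Type*} {G : SimpleGraph V} (hG : RainbowSat G 4) {n : ℕ}
    {M : Fin (n + 1) → Fin (n + 1) → ℕ} (hM : IsColorTable M) {φ : Fin (n + 1) → V}
    (hφ : Function.Injective φ)
    (hnbr : ∀ i, i ≠ 0 → ∀ u, G.Adj (φ i) u → ∃ j, u = φ j ∧ M i j ≠ 0)
    {x y : Fin (n + 1)} (hxy : x ≠ y) (hMxy : M x y ≠ 0)
    (hnadj : ¬ G.Adj (φ x) (φ y)) : False := by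
  classical
  obtain ⟨⟨c, hc, hfree⟩, hsat⟩ := hG
  obtain ⟨hsymm, hproper, hrain⟩ := hM
  set G' := G ⊔ SimpleGraph.fromEdgeSet {s(φ x, φ y)} with hG'
  have hadj' : ∀ a b, G'.Adj a b ↔ G.Adj a b ∨ (a = φ x ∧ b = φ y ∨ a = φ y ∧ b = φ x) := by
    intro a b
    have := hφ.ne hxy
    simp only [hG', SimpleGraph.sup_adj, SimpleGraph.fromEdgeSet_adj, Set.mem_singleton_iff,
      Sym2.eq_iff]
    grind
  have hnbr' : ∀ i, i ≠ 0 → ∀ u, G'.Adj (φ i) u → ∃ j, u = φ j ∧ M i j ≠ 0 := by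
    intro i hi u hu
    rcases (hadj' _ _).1 hu with h | ⟨h, rfl⟩ | ⟨h, rfl⟩
    · exact hnbr i hi u h
    · exact ⟨y, rfl, hφ h ▸ hMxy⟩
    · refine ⟨x, rfl, hφ h ▸ ?_⟩
      rwa [(hsymm _ _).1]
  have hM' : ∀ i j, G'.Adj (φ i) (φ j) → M i j ≠ 0 := by
    intro i j h
    by_cases hi : i = 0
    · have hj : j ≠ 0 := by
        rintro rfl
        exact h.ne (by rw [hi])
      obtain ⟨k, hk, hk'⟩ := hnbr' j hj _ h.symm
      rw [hφ hk, (hsymm _ _).1]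
      exact hk'
    · obtain ⟨k, hk, hk'⟩ := hnbr' i hi _ h
      rwa [hφ hk]
  let g : V → V → ℕ := fun a b =>
    if h : ∃ i j, a = φ i ∧ b = φ j then M h.choose h.choose_spec.choose else c s(a, b) + 10
  have g_in : ∀ i j, g (φ i) (φ j) = M i j := by
    intro i j
    have h : ∃ i' j', φ i = φ i' ∧ φ j = φ j' := ⟨i, j, rfl, rfl⟩
    have h₁ := hφ h.choose_spec.choose_spec.1
    have h₂ := hφ h.choose_spec.choose_spec.2
    exact (dif_pos h).trans (congrArg₂ M h₁.symm h₂.symm)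
  have g_out : ∀ a b, (¬ ∃ i j, a = φ i ∧ b = φ j) → g a b = c s(a, b) + 10 := by
    intro a b h
    simp only [g, dif_neg h]
  have g_symm : ∀ a b, g a b = g b a := by
    intro a b
    by_cases h : ∃ i j, a = φ i ∧ b = φ j
    · obtain ⟨i, j, rfl, rfl⟩ := h
      rw [g_in, g_in, (hsymm _ _).1]
    · rw [g_out _ _ h, g_out, Sym2.eq_swap]
      rintro ⟨i, j, rfl, rfl⟩
      exact h ⟨j, i, rfl, rfl⟩
  let c' : Sym2 V → ℕ := Sym2.lift ⟨g, g_symm⟩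
  have c'_mk : ∀ a b, c' s(a, b) = g a b := fun a b => rfl
  have adj_out : ∀ a b, G'.Adj a b → (¬ ∃ i j, a = φ i ∧ b = φ j) → G.Adj a b := by
    intro a b h h'
    rcases (hadj' _ _).1 h with h | ⟨rfl, rfl⟩ | ⟨rfl, rfl⟩
    · exact h
    · exact (h' ⟨_, _, rfl, rfl⟩).elim
    · exact (h' ⟨_, _, rfl, rfl⟩).elim
  have g_lt : ∀ a b, (∃ i j, a = φ i ∧ b = φ j) → g a b < 10 := by
    rintro _ _ ⟨i, j, rfl, rfl⟩
    rw [g_in]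
    exact (hsymm i j).2
  have hc' : ProperEdgeColoring G' c' := by
    have key : ∀ a b d, G'.Adj a b → G'.Adj a d → b ≠ d → c' s(a, b) ≠ c' s(a, d) := by
      intro a b d hab had hbd
      rw [c'_mk, c'_mk]
      by_cases h₁ : ∃ i j, a = φ i ∧ b = φ j <;> by_cases h₂ : ∃ i j, a = φ i ∧ d = φ j
      · obtain ⟨i, j, rfl, rfl⟩ := h₁
        obtain ⟨i', l, hi, rfl⟩ := h₂
        rw [g_in, g_in]
        exact hproper _ _ _ (fun h => hbd (h ▸ rfl)) (hM' _ _ hab)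
      · have := g_lt _ _ h₁
        rw [g_out _ _ h₂]
        omega
      · have := g_lt _ _ h₂
        rw [g_out _ _ h₁]
        omega
      · rw [g_out _ _ h₁, g_out _ _ h₂]
        have := hc s(a, b) (adj_out _ _ hab h₁) s(a, d) (adj_out _ _ had h₂)
          (by rwa [Ne, Sym2.congr_right]) ⟨a, by simp, by simp⟩
        omega
    rintro e₁ he₁ e₂ he₂ hne ⟨w, hw₁, hw₂⟩
    obtain ⟨b, rfl⟩ := hw₁
    obtain ⟨d, rfl⟩ := hw₂
    exact key w b d he₁ he₂ (fun h => hne (h ▸ rfl))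
  have h := (hasRainbowCycle_four_iff hc').1 (hsat _ _ (hφ.ne hxy) hnadj c' hc')
  obtain ⟨a, b, d, e, had, hbe, hab, hbd, hde, hea, h₁, h₂⟩ := h
  have inside : ∀ a b d e, b ≠ e → G'.Adj a b → G'.Adj b d → G'.Adj d e → G'.Adj e a →
      (∃ i, i ≠ 0 ∧ a = φ i) → ∃ i j k l, a = φ i ∧ b = φ j ∧ d = φ k ∧ e = φ l := by
    rintro a b d e hbe hab hbd hde hea ⟨i, hi, rfl⟩
    obtain ⟨j, rfl, -⟩ := hnbr' i hi _ hab
    obtain ⟨l, rfl, -⟩ := hnbr' i hi _ hea.symm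
    by_cases hj : j = 0
    · have hl : l ≠ 0 := by
        rintro rfl
        exact hbe (by rw [hj])
      obtain ⟨k, rfl, -⟩ := hnbr' l hl _ hde.symm
      exact ⟨i, j, k, l, rfl, rfl, rfl, rfl⟩
    · obtain ⟨k, rfl, -⟩ := hnbr' j hj _ hbd
      exact ⟨i, j, k, l, rfl, rfl, rfl, rfl⟩
  simp only [c'_mk] at h₁ h₂
  by_cases hin : ∃ i j k l, a = φ i ∧ b = φ j ∧ d = φ k ∧ e = φ l
  · obtain ⟨i, j, k, l, rfl, rfl, rfl, rfl⟩ := hin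
    simp only [g_in] at h₁ h₂
    rcases hrain i j k l ⟨hM' _ _ hab, fun h => had (h ▸ rfl), hM' _ _ hbd,
      fun h => hbe (h ▸ rfl), hM' _ _ hde, hM' _ _ hea⟩ with h | h
    · exact h₁ h
    · exact h₂ h
  · have ha : ¬ ∃ i, i ≠ 0 ∧ a = φ i := fun h =>
      hin (inside a b d e hbe hab hbd hde hea h)
    have hb : ¬ ∃ i, i ≠ 0 ∧ b = φ i := fun h => by
      obtain ⟨i, j, k, l, h⟩ := inside b d e a had.symm hbd hde hea hab h
      exact hin ⟨l, i, j, k, h.2.2.2, h.1, h.2.1, h.2.2.1⟩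
    have hd : ¬ ∃ i, i ≠ 0 ∧ d = φ i := fun h => by
      obtain ⟨i, j, k, l, h⟩ := inside d e a b hbe.symm hde hea hab hbd h
      exact hin ⟨k, l, i, j, h.2.2.1, h.2.2.2, h.1, h.2.1⟩
    have he : ¬ ∃ i, i ≠ 0 ∧ e = φ i := fun h => by
      obtain ⟨i, j, k, l, h⟩ := inside e a b d had hea hab hbd hde h
      exact hin ⟨j, k, l, i, h.2.1, h.2.2.1, h.2.2.2, h.1⟩
    have out : ∀ a b, G'.Adj a b → (¬ ∃ i, i ≠ 0 ∧ a = φ i) → (¬ ∃ i, i ≠ 0 ∧ b = φ i) →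
        ¬ ∃ i j, a = φ i ∧ b = φ j := by
      rintro a b hab ha hb ⟨i, j, rfl, rfl⟩
      have hi : i = 0 := by
        by_contra hi
        exact ha ⟨i, hi, rfl⟩
      have hj : j = 0 := by
        by_contra hj
        exact hb ⟨j, hj, rfl⟩
      exact hab.ne (by rw [hi, hj])
    have oab := out _ _ hab ha hb
    have obd := out _ _ hbd hb hd
    have ode := out _ _ hde hd he
    have oea := out _ _ hea he ha
    rw [g_out _ _ oab, g_out _ _ ode] at h₁
    rw [g_out _ _ obd, g_out _ _ oea] at h₂
    refine hfree ((hasRainbowCycle_four_iff hc).2 ⟨a, b, d, e, had, hbe, adj_out _ _ hab oab,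
      adj_out _ _ hbd obd, adj_out _ _ hde ode, adj_out _ _ hea oea, ?_, ?_⟩)
    · exact fun h => h₁ (by rw [h])
    · exact fun h => h₂ (by rw [h])

/-- The complete tripartite graph with parts of sizes 1, 1 and 4 has no proper colouring without
rainbow 4-cycles. -/
theorem hasRainbowCycle_of_fan {V : Type*} {G : SimpleGraph V} {c : Sym2 V → ℕ}
    (hc : ProperEdgeColoring G c) {v s : V} (hvs : v ≠ s) {b : Fin 4 → V}
    (hb : Function.Injective b) (hv : ∀ i, G.Adj v (b i)) (hs : ∀ i, G.Adj s (b i)) :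
    HasRainbowCycle G c 4 := by
  by_contra hfree
  rw [hasRainbowCycle_four_iff hc] at hfree
  have key : ∀ u, (∀ i, G.Adj u (b i)) → ∀ i j, i ≠ j → c s(u, b i) ≠ c s(u, b j) := by
    intro u hu i j hij
    refine hc _ (hu i) _ (hu j) ?_ ⟨u, by simp, by simp⟩
    simp only [ne_eq, Sym2.eq_iff, not_or, not_and]
    exact ⟨fun _ h => hij (hb h), fun h => absurd h (hu j).ne⟩
  have opp : ∀ i j, i ≠ j → c s(v, b i) = c s(s, b j) ∨ c s(s, b i) = c s(v, b j) := by
    intro i j hij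
    by_contra! h
    refine hfree ⟨v, b i, s, b j, hvs, hb.ne hij, hv i, (hs i).symm, hs j, (hv j).symm, h.1, ?_⟩
    rw [Sym2.eq_swap, Sym2.eq_swap (a := b j)]
    exact h.2
  have hα := key v hv
  have hβ := key s hs
  have := opp 0 1 (by decide)
  have := opp 0 2 (by decide)
  have := opp 0 3 (by decide)
  have := opp 1 2 (by decide)
  have := opp 1 3 (by decide)
  have := opp 2 3 (by decide)
  have := hα 0 1 (by decide)
  have := hα 0 2 (by decide)
  have := hα 0 3 (by decide)
  have := hα 1 2 (by decide)
  have := hα 1 3 (by decide)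
  have := hα 2 3 (by decide)
  have := hβ 0 1 (by decide)
  have := hβ 0 2 (by decide)
  have := hβ 0 3 (by decide)
  have := hβ 1 2 (by decide)
  have := hβ 1 3 (by decide)
  have := hβ 2 3 (by decide)
  omega

theorem restrictTo_adj {V : Type*} {G : SimpleGraph V} {A : Set V} {x y : V} :
    (restrictTo G A).Adj x y ↔ G.Adj x y ∧ x ∈ A ∧ y ∈ A := by
  simp only [restrictTo, SimpleGraph.fromRel_adj]
  constructor
  · rintro ⟨-, h | h⟩
    · exact h
    · exact ⟨h.1.symm, h.2.2, h.2.1⟩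
  · exact fun h => ⟨h.1.ne, Or.inl h⟩

theorem compOf_restrictTo_subset {V : Type*} {G : SimpleGraph V} {A : Set V} {x : V}
    (hx : x ∈ A) : compOf (restrictTo G A) x ⊆ A := by
  rintro y ⟨w⟩
  induction w with
  | nil => exact hx
  | cons h _ ih => exact ih (restrictTo_adj.1 h).2.2

/-- Vertices of a component can be listed so that each but the first has an earlier neighbour. -/
theorem exists_enumeration {V : Type*} [Finite V] (H : SimpleGraph V) (x : V) (k : ℕ)
    (hk : k + 1 ≤ (compOf H x).ncard) :
    ∃ (a : ℕ → V) (p : ℕ → ℕ), (∀ i < k + 1, a i ∈ compOf H x) ∧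
      Set.InjOn a (Set.Iio (k + 1)) ∧ p 0 = 0 ∧
      ∀ i < k + 1, 0 < i → p i < i ∧ H.Adj (a i) (a (p i)) := by
  induction k with
  | zero =>
    refine ⟨fun _ => x, fun _ => 0, fun _ _ => SimpleGraph.Reachable.refl x, ?_, rfl, ?_⟩
    · intro i hi j hj _
      simp only [Set.mem_Iio] at hi hj
      omega
    · intro i hi hi'
      omega
  | succ k ih =>
    obtain ⟨a, p, hmem, hinj, hp0, hp⟩ := ih (by omega)
    have hcard : (a '' Set.Iio (k + 1)).ncard = k + 1 := by
      rw [hinj.ncard_image]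
      simp [Set.ncard_eq_toFinset_card']
    obtain ⟨y, hy, hyS⟩ := Set.exists_mem_notMem_of_ncard_lt_ncard
      (s := a '' Set.Iio (k + 1)) (t := compOf H x) (by omega)
    have h0 : a 0 ∈ a '' Set.Iio (k + 1) := ⟨0, by simp, rfl⟩
    obtain ⟨w⟩ : H.Reachable (a 0) y := (hmem 0 (by omega)).symm.trans hy
    obtain ⟨d, -, ⟨j, hj, hjd⟩, hd⟩ := w.exists_boundary_dart _ h0 hyS
    simp only [Set.mem_Iio] at hj
    refine ⟨Function.update a (k + 1) d.snd, Function.update p (k + 1) j, ?_, ?_,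
      by rwa [Function.update_of_ne (by omega)], ?_⟩
    · intro i hi
      rcases Nat.lt_succ_iff_lt_or_eq.1 hi with h | rfl
      · rw [Function.update_of_ne h.ne]
        exact hmem i h
      · rw [Function.update_self]
        have hr : H.Reachable x (a j) := hmem j hj
        rw [hjd] at hr
        exact hr.trans d.adj.reachable
    · have hd' : ∀ i < k + 1, a i ≠ d.snd := fun i hi h => hd ⟨i, hi, h⟩
      intro i hi l hl
      simp only [Set.mem_Iio] at hi hl
      rcases Nat.lt_succ_iff_lt_or_eq.1 hi with h | rfl <;>
        rcases Nat.lt_succ_iff_lt_or_eq.1 hl with h' | rfl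
      · rw [Function.update_of_ne h.ne, Function.update_of_ne h'.ne]
        exact fun e => hinj h h' e
      · rw [Function.update_of_ne h.ne, Function.update_self]
        exact fun e => (hd' _ h e).elim
      · rw [Function.update_of_ne h'.ne, Function.update_self]
        exact fun e => (hd' _ h' e.symm).elim
      · exact fun _ => rfl
    · intro i hi hi0
      rcases Nat.lt_succ_iff_lt_or_eq.1 hi with h | rfl
      · obtain ⟨h₁, h₂⟩ := hp i h hi0
        rw [Function.update_of_ne h.ne, Function.update_of_ne h.ne,
          Function.update_of_ne (by omega)]
        exact ⟨h₁, h₂⟩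
      · rw [Function.update_self, Function.update_self, Function.update_of_ne hj.ne, hjd]
        exact ⟨hj, d.adj.symm⟩

/-- If a component inside `N(v)` with a listing as in `exists_enumeration` meets only
`2 * n - 1` edges, then all its edges go to `v` or from a vertex to its chosen earlier neighbour. -/
theorem adj_of_edgesTouching {V : Type*} [Finite V] {G : SimpleGraph V} {C : Set V} {v : V}
    {n : ℕ} {a : ℕ → V} {p : ℕ → ℕ} (hv : ∀ i < n, G.Adj v (a i)) (hvC : v ∉ C)
    (hmem : ∀ i < n, a i ∈ C) (hinj : Set.InjOn a (Set.Iio n))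
    (hp : ∀ i < n, 0 < i → p i < i ∧ G.Adj (a i) (a (p i)))
    (hcard : edgesTouching G C + 1 ≤ 2 * n) {i : ℕ} (hi : i < n) {u : V} (hu : G.Adj (a i) u) :
    u = v ∨ ∃ j < n, u = a j ∧ (0 < i ∧ p i = j ∨ 0 < j ∧ p j = i) := by
  classical
  let E₁ : Finset (Sym2 V) := (Finset.range n).image fun i => s(v, a i)
  let E₂ : Finset (Sym2 V) := (Finset.Ico 1 n).image fun i => s(a i, a (p i))
  have hva : ∀ i < n, a i ≠ v := fun i hi h => hvC (h ▸ hmem i hi)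
  have c₁ : E₁.card = n := by
    rw [Finset.card_image_of_injOn, Finset.card_range]
    intro i hi j hj h
    simp only [Finset.coe_range, Set.mem_Iio] at hi hj
    rcases Sym2.eq_iff.1 h with ⟨-, h⟩ | ⟨h, -⟩
    · exact hinj hi hj h
    · exact (hva _ hj h.symm).elim
  have c₂ : E₂.card = n - 1 := by
    rw [Finset.card_image_of_injOn, Nat.card_Ico]
    intro i hi j hj h
    simp only [Finset.coe_Ico, Set.mem_Ico] at hi hj
    have h₁ := (hp i hi.2 hi.1).1
    have h₂ := (hp j hj.2 hj.1).1
    rcases Sym2.eq_iff.1 h with ⟨h, -⟩ | ⟨h, h'⟩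
    · exact hinj hi.2 hj.2 h
    · have e₁ := hinj hi.2 (show p j < n by omega) h
      have e₂ := hinj (show p i < n by omega) hj.2 h'
      omega
  have hdisj : Disjoint E₁ E₂ := by
    rw [Finset.disjoint_left]
    intro e h₁ h₂
    obtain ⟨i, hi, rfl⟩ := Finset.mem_image.1 h₁
    obtain ⟨j, hj, h⟩ := Finset.mem_image.1 h₂
    have hj := Finset.mem_Ico.1 hj
    have := (hp j hj.2 hj.1).1
    rcases Sym2.eq_iff.1 h with ⟨h, -⟩ | ⟨-, h⟩
    · exact hva _ hj.2 h
    · exact hva _ (by omega) h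
  have hsub : (↑(E₁ ∪ E₂) : Set (Sym2 V)) ⊆ {e | e ∈ G.edgeSet ∧ ∃ w ∈ C, w ∈ e} := by
    intro e he
    rcases Finset.mem_union.1 (Finset.mem_coe.1 he) with h | h
    · obtain ⟨i, hi, rfl⟩ := Finset.mem_image.1 h
      have hi := Finset.mem_range.1 hi
      exact ⟨hv i hi, a i, hmem i hi, by simp⟩
    · obtain ⟨j, hj, rfl⟩ := Finset.mem_image.1 h
      have hj := Finset.mem_Ico.1 hj
      exact ⟨(hp j hj.2 hj.1).2, a j, hmem j hj.2, by simp⟩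
  have heq := Set.eq_of_subset_of_ncard_le hsub (by
    rw [Set.ncard_coe_finset, Finset.card_union_of_disjoint hdisj, c₁, c₂]
    unfold edgesTouching at hcard
    omega) (Set.toFinite _)
  have hmemE : s(a i, u) ∈ (↑(E₁ ∪ E₂) : Set (Sym2 V)) := by
    rw [heq]
    exact ⟨hu, a i, hmem i hi, by simp⟩
  rcases Finset.mem_union.1 (Finset.mem_coe.1 hmemE) with h | h
  · obtain ⟨j, hj, h⟩ := Finset.mem_image.1 h
    rcases Sym2.eq_iff.1 h with ⟨h, -⟩ | ⟨h, -⟩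
    · exact (hva _ hi h.symm).elim
    · exact Or.inl h.symm
  · obtain ⟨j, hj, h⟩ := Finset.mem_image.1 h
    have hj := Finset.mem_Ico.1 hj
    have := (hp j hj.2 hj.1).1
    rcases Sym2.eq_iff.1 h with ⟨h, h'⟩ | ⟨h, h'⟩
    · obtain rfl := hinj hj.2 hi h
      exact Or.inr ⟨p j, by omega, h'.symm, Or.inl ⟨hj.1, rfl⟩⟩
    · have := hinj (show p j < n by omega) hi h'
      exact Or.inr ⟨j, hj.2, h.symm, Or.inr ⟨hj.1, this⟩⟩

/-- Adjacency in the tree on `Fin n` in which the parent of each `i ≠ 0` is `p i`. -/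
def ParentAdj {n : ℕ} (p : Fin n → ℕ) (i j : Fin n) : Prop :=
  0 < i.1 ∧ p i = j.1 ∨ 0 < j.1 ∧ p j = i.1

instance {n : ℕ} (p : Fin n → ℕ) (i j : Fin n) : Decidable (ParentAdj p i j) := by
  unfold ParentAdj
  infer_instance

/-- The relabelling `τ` embeds the tree with parent function `p` into the graph coloured by `M`,
where `0` is reserved for the apex, and the edge of `M` between `1` and `3` is not used. -/
def FitsTable {n : ℕ} (p : Fin (n + 3) → ℕ) (M : Fin (n + 4) → Fin (n + 4) → ℕ)
    (τ : Fin (n + 3) → Fin (n + 3)) : Prop :=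
  (∀ i j, τ i = τ j → i = j) ∧ ¬ ParentAdj p (τ 0) (τ 2) ∧
    ∀ i j, ParentAdj p (τ i) (τ j) → M i.succ j.succ ≠ 0

instance {n : ℕ} (p : Fin (n + 3) → ℕ) (M : Fin (n + 4) → Fin (n + 4) → ℕ)
    (τ : Fin (n + 3) → Fin (n + 3)) : Decidable (FitsTable p M τ) := by
  unfold FitsTable
  infer_instance

theorem RainbowSat.false_of_fitsTable {V : Type*} {G : SimpleGraph V} (hG : RainbowSat G 4)
    {n : ℕ} {p : Fin (n + 3) → ℕ} {M : Fin (n + 4) → Fin (n + 4) → ℕ}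
    {τ : Fin (n + 3) → Fin (n + 3)} (hM : IsColorTable M) (h0 : ∀ i : Fin (n + 3), M i.succ 0 ≠ 0)
    (hM02 : M (Fin.succ 0) (Fin.succ 2) ≠ 0) (hτ : FitsTable p M τ) {v : V} {a : Fin (n + 3) → V}
    (ha : Function.Injective a) (hva : ∀ i, a i ≠ v)
    (hnbr : ∀ i u, G.Adj (a i) u → u = v ∨ ∃ j, u = a j ∧ ParentAdj p i j) : False := by
  obtain ⟨hinj, hnot, hfit⟩ := hτ
  have hinj : Function.Injective τ := fun i j => hinj i j
  refine hG.false_of_block hM (φ := Fin.cons v (a ∘ τ)) (x := Fin.succ 0) (y := Fin.succ 2)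
    ?_ ?_ ?_ hM02 ?_
  · rw [Fin.cons_injective_iff]
    exact ⟨by rintro ⟨i, hi⟩; exact hva _ hi, ha.comp hinj⟩
  · intro i hi u hu
    obtain ⟨i, rfl⟩ := Fin.exists_succ_eq.2 hi
    rw [Fin.cons_succ] at hu
    rcases hnbr _ _ hu with rfl | ⟨j, rfl, hj⟩
    · exact ⟨0, rfl, h0 i⟩
    · obtain ⟨l, rfl⟩ := (Finite.injective_iff_surjective.1 hinj) j
      exact ⟨l.succ, by simp, hfit _ _ hj⟩
  · rw [(Fin.succ_injective _).ne_iff, Ne, Fin.ext_iff]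
    simp [Nat.mod_eq_of_lt (show 2 < n + 3 by omega)]
  · rw [Fin.cons_succ, Fin.cons_succ]
    intro h
    rcases hnbr _ _ h with h | ⟨j, h, hj⟩
    · exact hva _ h
    · rw [← ha h] at hj
      exact hnot hj

/-- The fan over the path 1-2-3, with the edge 13 added. -/
def pathTable₃ : Fin 4 → Fin 4 → ℕ :=
  ![![0, 2, 3, 1],
    ![2, 0, 1, 3],
    ![3, 1, 0, 2],
    ![1, 3, 2, 0]]

/-- The fan over the path 1-2-3-4, with the edge 13 added. -/
def pathTable₄ : Fin 5 → Fin 5 → ℕ :=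
  ![![0, 2, 3, 1, 4],
    ![2, 0, 1, 4, 0],
    ![3, 1, 0, 2, 0],
    ![1, 4, 2, 0, 3],
    ![4, 0, 0, 3, 0]]

/-- The fan over the star with centre 2 and leaves 1, 3, 4, with the edge 13 added. -/
def starTable₄ : Fin 5 → Fin 5 → ℕ :=
  ![![0, 2, 4, 3, 1],
    ![2, 0, 1, 4, 0],
    ![4, 1, 0, 2, 3],
    ![3, 4, 2, 0, 0],
    ![1, 0, 3, 0, 0]]

/-- The fan over the path 1-2-3-4-5, with the edge 13 added. -/
def pathTable₅ : Fin 6 → Fin 6 → ℕ :=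
  ![![0, 2, 3, 1, 4, 5],
    ![2, 0, 1, 4, 0, 0],
    ![3, 1, 0, 2, 0, 0],
    ![1, 4, 2, 0, 3, 0],
    ![4, 0, 0, 3, 0, 1],
    ![5, 0, 0, 0, 1, 0]]

/-- The fan over the tree 1-2-3, 2-4-5, with the edge 13 added. -/
def spiderTable₅ : Fin 6 → Fin 6 → ℕ :=
  ![![0, 2, 4, 3, 1, 5],
    ![2, 0, 1, 4, 0, 0],
    ![4, 1, 0, 2, 3, 0],
    ![3, 4, 2, 0, 0, 0],
    ![1, 0, 3, 0, 0, 4],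
    ![5, 0, 0, 0, 4, 0]]

theorem fitsTable_three {p : Fin 3 → ℕ} (h0 : p 0 = 0) (h1 : p 1 < 1) (h2 : p 2 < 2) :
    ∃ τ, FitsTable p pathTable₃ τ := by
  have hp : p = ![p 0, p 1, p 2] := by
    funext i
    fin_cases i <;> rfl
  rw [hp, h0]
  generalize p 1 = q1, p 2 = q2 at *
  interval_cases q1
  interval_cases q2
  · exact ⟨![1, 0, 2], by decide⟩
  · exact ⟨![0, 1, 2], by decide⟩

theorem fitsTable_four {p : Fin 4 → ℕ} (h0 : p 0 = 0) (h1 : p 1 < 1) (h2 : p 2 < 2) (h3 : p 3 < 3) :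
    ∃ τ, FitsTable p pathTable₄ τ ∨ FitsTable p starTable₄ τ := by
  have hp : p = ![p 0, p 1, p 2, p 3] := by
    funext i
    fin_cases i <;> rfl
  rw [hp, h0]
  generalize p 1 = q1, p 2 = q2, p 3 = q3 at *
  interval_cases q1
  interval_cases q2 <;> interval_cases q3
  · exact ⟨![1, 0, 2, 3], .inr (by decide)⟩
  · exact ⟨![2, 0, 1, 3], .inl (by decide)⟩
  · exact ⟨![1, 0, 2, 3], .inl (by decide)⟩
  · exact ⟨![2, 1, 0, 3], .inl (by decide)⟩
  · exact ⟨![0, 1, 2, 3], .inr (by decide)⟩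
  · exact ⟨![0, 1, 2, 3], .inl (by decide)⟩

theorem fitsTable_five {p : Fin 5 → ℕ} (h0 : p 0 = 0) (h1 : p 1 < 1) (h2 : p 2 < 2) (h3 : p 3 < 3)
    (h4 : p 4 < 4) :
    (∃ τ, FitsTable p pathTable₅ τ ∨ FitsTable p spiderTable₅ τ) ∨
      ∃ s, ∀ i, i ≠ s → ParentAdj p s i := by
  have hp : p = ![p 0, p 1, p 2, p 3, p 4] := by
    funext i
    fin_cases i <;> rfl
  rw [hp, h0]
  generalize p 1 = q1, p 2 = q2, p 3 = q3, p 4 = q4 at *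
  interval_cases q1
  interval_cases q2 <;> interval_cases q3 <;> interval_cases q4
  · exact .inr ⟨0, by decide⟩
  · exact .inl ⟨![2, 0, 3, 1, 4], .inr (by decide)⟩
  · exact .inl ⟨![1, 0, 3, 2, 4], .inr (by decide)⟩
  · exact .inl ⟨![1, 0, 2, 3, 4], .inr (by decide)⟩
  · exact .inl ⟨![2, 0, 4, 1, 3], .inr (by decide)⟩
  · exact .inl ⟨![3, 1, 4, 0, 2], .inr (by decide)⟩
  · exact .inl ⟨![3, 1, 0, 2, 4], .inl (by decide)⟩
  · exact .inl ⟨![2, 0, 1, 3, 4], .inl (by decide)⟩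
  · exact .inl ⟨![1, 0, 4, 2, 3], .inr (by decide)⟩
  · exact .inl ⟨![3, 2, 0, 1, 4], .inl (by decide)⟩
  · exact .inl ⟨![3, 2, 4, 0, 1], .inr (by decide)⟩
  · exact .inl ⟨![1, 0, 2, 3, 4], .inl (by decide)⟩
  · exact .inl ⟨![3, 0, 4, 1, 2], .inr (by decide)⟩
  · exact .inl ⟨![2, 1, 4, 0, 3], .inr (by decide)⟩
  · exact .inl ⟨![3, 0, 1, 2, 4], .inl (by decide)⟩
  · exact .inl ⟨![2, 1, 0, 3, 4], .inl (by decide)⟩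
  · exact .inl ⟨![2, 1, 3, 0, 4], .inr (by decide)⟩
  · exact .inr ⟨1, by decide⟩
  · exact .inl ⟨![0, 1, 3, 2, 4], .inr (by decide)⟩
  · exact .inl ⟨![0, 1, 2, 3, 4], .inr (by decide)⟩
  · exact .inl ⟨![3, 2, 1, 0, 4], .inl (by decide)⟩
  · exact .inl ⟨![0, 1, 4, 2, 3], .inr (by decide)⟩
  · exact .inl ⟨![3, 2, 4, 1, 0], .inr (by decide)⟩
  · exact .inl ⟨![0, 1, 2, 3, 4], .inl (by decide)⟩

/-- Claim 8, part 2: in a rainbow `C₄`-saturated graph `G` with dominating set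
`D` and `v ∈ D`, no connected component of `G[N(v) ∖ D]` that contains a vertex
of `L` and is simultaneously a connected component of `G[V ∖ D]` has between 3
and 5 vertices. -/
theorem rainbow_sat_C4_no_medium_L_components {V : Type*} [Fintype V]
    (G : SimpleGraph V) (hG : RainbowSat G 4) (D : Set V)
    (hD : ∀ v, v ∈ D ∨ ∃ u ∈ D, G.Adj u v) (v : V) (hv : v ∈ D) :
    ¬ ∃ x, G.Adj v x ∧ x ∉ D ∧
        (∃ w ∈ compOf (restrictTo G (G.neighborSet v \ D)) x, w ∈ Lset G D) ∧
        compOf (restrictTo G (G.neighborSet v \ D)) x = compOf (restrictTo G Dᶜ) x ∧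
        3 ≤ (compOf (restrictTo G (G.neighborSet v \ D)) x).ncard ∧
        (compOf (restrictTo G (G.neighborSet v \ D)) x).ncard ≤ 5 := by
  classical
  rintro ⟨x, hvx, hxD, ⟨w, hw, hwL⟩, hcomp, h3, h5⟩
  have hsub : compOf (restrictTo G (G.neighborSet v \ D)) x ⊆ G.neighborSet v \ D :=
    compOf_restrictTo_subset ⟨hvx, hxD⟩
  have hwcomp : compOf (restrictTo G Dᶜ) w = compOf (restrictTo G Dᶜ) x := by
    rw [hcomp] at hw
    have hw : (restrictTo G Dᶜ).Reachable x w := hw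
    ext y
    exact ⟨fun h => hw.trans h, fun h => hw.symm.trans h⟩
  have hsparse := hwL.2.1
  rw [hwcomp, ← hcomp] at hsparse
  have henum := exists_enumeration (restrictTo G (G.neighborSet v \ D)) x
  generalize compOf (restrictTo G (G.neighborSet v \ D)) x = C at *
  obtain ⟨n, hn⟩ : ∃ n, C.ncard = n + 1 := ⟨C.ncard - 1, by omega⟩
  obtain ⟨a, p, hmem, hinj, hp0, hp⟩ := henum n hn.ge
  have hp : ∀ i < n + 1, 0 < i → p i < i ∧ G.Adj (a i) (a (p i)) := fun i hi h =>
    ⟨(hp i hi h).1, (restrictTo_adj.1 (hp i hi h).2).1⟩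
  have hvC : v ∉ C := fun h => G.irrefl (hsub h).1
  have hva : ∀ i < n + 1, G.Adj v (a i) := fun i hi => (hsub (hmem i hi)).1
  have hadj := fun i hi u => adj_of_edgesTouching hva hvC hmem hinj hp
    (by rw [← hn]; exact hsparse.le) (i := i) hi (u := u)
  have hinj' : Function.Injective (fun i : Fin (n + 1) => a i) := fun i j h =>
    Fin.ext (hinj i.2 j.2 h)
  have hne : ∀ i : Fin (n + 1), a i ≠ v := fun i => (hva i i.2).ne'
  have hnbr : ∀ (i : Fin (n + 1)) u, G.Adj (a i) u →
      u = v ∨ ∃ j : Fin (n + 1), u = a j ∧ ParentAdj (fun i : Fin (n + 1) => p i) i j := by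
    intro i u hu
    rcases hadj i i.2 u hu with h | ⟨j, hj, h, h'⟩
    · exact .inl h
    · exact .inr ⟨⟨j, hj⟩, h, h'⟩
  have hlt : ∀ i < n + 1, 0 < i → p i < i := fun i hi h => (hp i hi h).1
  obtain rfl | rfl | rfl : n = 2 ∨ n = 3 ∨ n = 4 := by omega
  · obtain ⟨τ, hτ⟩ := fitsTable_three (p := fun i => p i) hp0 (hlt 1 (by simp) (by simp))
      (hlt 2 (by simp) (by simp))
    exact hG.false_of_fitsTable (by decide +kernel) (by decide) (by decide) hτ hinj' hne hnbr
  · obtain ⟨τ, hτ | hτ⟩ := fitsTable_four (p := fun i => p i) hp0 (hlt 1 (by simp) (by simp))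
      (hlt 2 (by simp) (by simp)) (hlt 3 (by simp) (by simp))
    · exact hG.false_of_fitsTable (by decide +kernel) (by decide) (by decide) hτ hinj' hne hnbr
    · exact hG.false_of_fitsTable (by decide +kernel) (by decide) (by decide) hτ hinj' hne hnbr
  · obtain ⟨τ, hτ | hτ⟩ | ⟨s, hs⟩ := fitsTable_five (p := fun i => p i) hp0
      (hlt 1 (by simp) (by simp)) (hlt 2 (by simp) (by simp)) (hlt 3 (by simp) (by simp))
      (hlt 4 (by simp) (by simp))
    · exact hG.false_of_fitsTable (by decide +kernel) (by decide) (by decide) hτ hinj' hne hnbr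
    · exact hG.false_of_fitsTable (by decide +kernel) (by decide) (by decide) hτ hinj' hne hnbr
    · obtain ⟨c, hc, hfree⟩ := hG.1
      refine hfree (hasRainbowCycle_of_fan hc (hne s).symm
        (b := fun i : Fin 4 => a (s.succAbove i)) (hinj'.comp Fin.succAbove_right_injective)
        (fun i => hva _ (s.succAbove i).2) fun i => ?_)
      rcases hs _ (Fin.succAbove_ne s i) with ⟨h, h'⟩ | ⟨h, h'⟩
      · have := (hp s s.2 h).2
        rwa [show p s = s.succAbove i from h'] at this
      · have := (hp _ (s.succAbove i).2 h).2
        rw [show p (s.succAbove i) = s from h'] at this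
        exact this.symm
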